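/- Let 0 < p ≤ 1/2 and assume λ = sup_k m_k < ∞. There exists a constant c, depending only on λ, such that the following holds. Let N ∈ ℕ_+, let a : G_m → ℂ be bounded measurable with support contained in I_N, ‖a‖_∞ ≤ M_N^{1/p}, and ∫_{G_m} a dμ = 0. Then for every n ∈ ℕ_+ with n ≥ M_N, every pair 0 ≤ i < j ≤ N, and every x ∈ I_N^{i,j}, one has |σ_n a(x)| ≤ c · M_N^{1/p − 2} M_i M_j. -/

import Mathlib

open MeasureTheory Finset

noncomputable section

namespace Vilenkin

instance (n : ℕ) : MeasurableSpace (ZMod n) := ⊤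

abbrev G (m : ℕ → ℕ) : Type := ∀ k, ZMod (m k)

def M (m : ℕ → ℕ) : ℕ → ℕ
  | 0 => 1
  | k + 1 => m k * M m k

def digit (m : ℕ → ℕ) (n k : ℕ) : ℕ := (n / M m k) % m k

def rad (m : ℕ → ℕ) (k : ℕ) (x : G m) : ℂ :=
  Complex.exp (2 * (Real.pi : ℂ) * Complex.I * ((x k).val : ℂ) / (m k : ℂ))

def psi (m : ℕ → ℕ) (n : ℕ) (x : G m) : ℂ :=
  ∏ k ∈ Finset.range (n + 1), rad m k x ^ digit m n k

def D (m : ℕ → ℕ) (n : ℕ) (x : G m) : ℂ := ∑ k ∈ Finset.range n, psi m k x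

def K (m : ℕ → ℕ) (n : ℕ) (x : G m) : ℂ := (n : ℂ)⁻¹ * ∑ k ∈ Finset.range n, D m k x

def cyl (m : ℕ → ℕ) (n : ℕ) (x : G m) : Set (G m) := {y | ∀ j < n, y j = x j}

def e (m : ℕ → ℕ) (k : ℕ) : G m := fun j => if j = k then 1 else 0

def lo (m : ℕ → ℕ) (n : ℕ) : ℕ := sInf {j | digit m n j ≠ 0}

def hi (m : ℕ → ℕ) (n : ℕ) : ℕ := sSup {j | digit m n j ≠ 0}

def Iij (m : ℕ → ℕ) (N i j : ℕ) : Set (G m) :=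
  if j = N then {x | x i ≠ 0 ∧ ∀ t < N, t ≠ i → x t = 0}
  else {x | (∀ t < i, x t = 0) ∧ x i ≠ 0 ∧ (∀ t, i < t → t < j → x t = 0) ∧ x j ≠ 0}

def IsVilenkinMeasure (m : ℕ → ℕ) (μ : Measure (G m)) : Prop :=
  IsProbabilityMeasure μ ∧ ∀ (n : ℕ) (x : G m), μ (cyl m n x) = (M m n : ENNReal)⁻¹

def fhat (m : ℕ → ℕ) (μ : Measure (G m)) (f : G m → ℂ) (k : ℕ) : ℂ :=
  ∫ x, f x * (starRingEnd ℂ) (psi m k x) ∂μ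

def S (m : ℕ → ℕ) (μ : Measure (G m)) (f : G m → ℂ) (n : ℕ) (x : G m) : ℂ :=
  ∑ k ∈ Finset.range n, fhat m μ f k * psi m k x

def sigma (m : ℕ → ℕ) (μ : Measure (G m)) (f : G m → ℂ) (n : ℕ) (x : G m) : ℂ :=
  (n : ℂ)⁻¹ * ∑ k ∈ Finset.range n, S m μ f k x

end Vilenkin

namespace Vilenkin

section Blocks

variable {u w : ℕ → ℂ} {P : ℕ}

lemma sum_range_mul_of_block (h : ∀ q, ∀ r < P, u (q * P + r) = w q * u r) (b : ℕ) :
    ∑ k ∈ range (b * P), u k = (∑ q ∈ range b, w q) * ∑ k ∈ range P, u k := by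
  induction b with
  | zero => simp
  | succ b ih =>
    rw [Nat.succ_mul, sum_range_add, ih, sum_range_succ, add_mul, mul_sum (range P) u (w b)]
    congr 1
    exact sum_congr rfl fun r hr => h b r (mem_range.1 hr)

lemma sum_range_of_block (h : ∀ q, ∀ r < P, u (q * P + r) = w q * u r)
    (h0 : ∑ k ∈ range P, u k = 0) (q r : ℕ) (hr : r < P) :
    ∑ k ∈ range (q * P + r), u k = w q * ∑ k ∈ range r, u k := by
  rw [sum_range_add, sum_range_mul_of_block h, h0, mul_zero, zero_add, mul_sum]
  exact sum_congr rfl fun k hk => h q k ((mem_range.1 hk).trans hr)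

lemma norm_sum_range_le_of_block (hP : 0 < P)
    (h : ∀ q, ∀ r < P, u (q * P + r) = w q * u r) (hw : ∀ q, ‖w q‖ ≤ 1)
    (h0 : ∑ k ∈ range P, u k = 0) {C : ℝ} (hu : ∀ k, ‖u k‖ ≤ C) (n : ℕ) :
    ‖∑ k ∈ range n, u k‖ ≤ P * C := by
  have hC : 0 ≤ C := (norm_nonneg _).trans (hu 0)
  have hr : n % P < P := Nat.mod_lt _ hP
  have hn : n / P * P + n % P = n := Nat.div_add_mod' n P
  rw [← hn, sum_range_of_block h h0 _ _ hr, norm_mul]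
  calc ‖w (n / P)‖ * ‖∑ k ∈ range (n % P), u k‖
      ≤ 1 * ∑ k ∈ range (n % P), ‖u k‖ :=
        mul_le_mul (hw _) (norm_sum_le _ _) (norm_nonneg _) zero_le_one
    _ ≤ (n % P : ℕ) * C := by
        rw [one_mul]
        simpa using sum_le_card_nsmul (range (n % P)) _ C fun k _ => hu k
    _ ≤ P * C := by gcongr

end Blocks

variable {m : ℕ → ℕ}

lemma M_pos (hm : ∀ k, 2 ≤ m k) (k : ℕ) : 0 < M m k := by
  induction k with
  | zero => simp [M]
  | succ k ih => exact Nat.mul_pos (by have := hm k; omega) ih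

lemma lt_M (hm : ∀ k, 2 ≤ m k) (k : ℕ) : k < M m k := by
  induction k with
  | zero => simp [M]
  | succ k ih =>
    have := Nat.mul_le_mul_right (M m k) (hm k)
    simp only [M]
    omega

lemma M_dvd {s k : ℕ} (h : s ≤ k) : M m s ∣ M m k := by
  induction k, h using Nat.le_induction with
  | base => exact dvd_rfl
  | succ k _ ih => exact ih.mul_left _

lemma M_mono (hm : ∀ k, 2 ≤ m k) : Monotone (M m) := fun _ b h =>
  Nat.le_of_dvd (M_pos hm b) (M_dvd h)

lemma digit_of_lt {n k : ℕ} (h : n < M m k) : digit m n k = 0 := by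
  simp [digit, Nat.div_eq_of_lt h]

lemma digit_mul_M_add_of_lt (hm : ∀ k, 2 ≤ m k) (q r : ℕ) {s k : ℕ} (h : k < s) :
    digit m (q * M m s + r) k = digit m r k := by
  obtain ⟨d, hd⟩ := M_dvd (m := m) (Nat.succ_le_of_lt h)
  have : q * M m s + r = r + M m k * (m k * (d * q)) := by
    rw [hd, M]; ring
  rw [digit, digit, this, Nat.add_mul_div_left _ _ (M_pos hm k), Nat.add_mul_mod_self_left]

lemma digit_mul_M_add_of_le (hm : ∀ k, 2 ≤ m k) (q : ℕ) {r s k : ℕ} (h : s ≤ k)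
    (hr : r < M m s) : digit m (q * M m s + r) k = digit m (q * M m s) k := by
  obtain ⟨d, hd⟩ := M_dvd (m := m) h
  rw [digit, digit, hd, ← Nat.div_div_eq_div_mul, ← Nat.div_div_eq_div_mul,
    Nat.mul_div_cancel _ (M_pos hm s), mul_comm q, Nat.mul_add_div (M_pos hm s),
    Nat.div_eq_of_lt hr, add_zero]

lemma digit_mul_M_self (hm : ∀ k, 2 ≤ m k) {a s : ℕ} (ha : a < m s) :
    digit m (a * M m s) s = a := by
  rw [digit, Nat.mul_div_cancel _ (M_pos hm s), Nat.mod_eq_of_lt ha]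

lemma psi_eq_prod (hm : ∀ k, 2 ≤ m k) {n L : ℕ} (h : n < M m L) (x : G m) :
    psi m n x = ∏ k ∈ range L, rad m k x ^ digit m n k := by
  have key : ∀ L₁ L₂, L₁ ≤ L₂ → n < M m L₁ →
      ∏ k ∈ range L₁, rad m k x ^ digit m n k = ∏ k ∈ range L₂, rad m k x ^ digit m n k := by
    intro L₁ L₂ h12 h1
    refine prod_subset (range_subset_range.2 h12) fun k _ hk => ?_
    rw [mem_range, not_lt] at hk
    rw [digit_of_lt (h1.trans_le (M_mono hm hk)), pow_zero]
  have h' : n < M m (n + 1) := (Nat.lt_succ_self n).trans (lt_M hm _)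
  rw [psi]
  rcases le_total (n + 1) L with hL | hL
  · exact key _ _ hL h'
  · exact (key _ _ hL h).symm

lemma psi_mul_M_add (hm : ∀ k, 2 ≤ m k) (q : ℕ) {r s : ℕ} (hr : r < M m s) (x : G m) :
    psi m (q * M m s + r) x = psi m (q * M m s) x * psi m r x := by
  have hL := lt_M hm (q * M m s + r)
  rw [psi_eq_prod hm hL, psi_eq_prod hm ((Nat.le_add_right _ _).trans_lt hL),
    psi_eq_prod hm ((Nat.le_add_left _ _).trans_lt hL), ← prod_mul_distrib]
  refine prod_congr rfl fun k _ => ?_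
  rcases lt_or_ge k s with h | h
  · have h0 : digit m (q * M m s) k = 0 := by
      simpa [digit] using digit_mul_M_add_of_lt hm q 0 h
    rw [digit_mul_M_add_of_lt hm q r h, h0, pow_zero, one_mul]
  · rw [digit_mul_M_add_of_le hm q h hr, digit_of_lt (hr.trans_le (M_mono hm h)), pow_zero,
      mul_one]

lemma psi_mul_M (hm : ∀ k, 2 ≤ m k) {a s : ℕ} (ha : a < m s) (x : G m) :
    psi m (a * M m s) x = rad m s x ^ a := by
  have hL : a * M m s < M m (s + 1) := Nat.mul_lt_mul_of_pos_right ha (M_pos hm s)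
  rw [psi_eq_prod hm hL, prod_range_succ, digit_mul_M_self hm ha, prod_eq_one, one_mul]
  intro k hk
  have h0 : digit m (a * M m s) k = 0 := by
    simpa [digit] using digit_mul_M_add_of_lt hm a 0 (mem_range.1 hk)
  rw [h0, pow_zero]

lemma norm_rad (k : ℕ) (x : G m) : ‖rad m k x‖ = 1 := by
  rw [rad, show 2 * (Real.pi : ℂ) * Complex.I * ((x k).val : ℂ) / (m k : ℂ) =
    ((2 * Real.pi * (x k).val / m k : ℝ) : ℂ) * Complex.I by push_cast; ring]
  exact Complex.norm_exp_ofReal_mul_I _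

lemma norm_psi (n : ℕ) (x : G m) : ‖psi m n x‖ = 1 := by
  simp [psi, norm_prod, norm_rad]

lemma rad_of_eq_zero {k : ℕ} {x : G m} (h : x k = 0) : rad m k x = 1 := by
  simp [rad, h]

lemma sum_rad_pow_eq_zero (hm : ∀ k, 2 ≤ m k) {k : ℕ} {x : G m} (h : x k ≠ 0) :
    ∑ a ∈ range (m k), rad m k x ^ a = 0 := by
  have hk : m k ≠ 0 := by have := hm k; omega
  have : NeZero (m k) := ⟨hk⟩
  have hz := Complex.isPrimitiveRoot_exp (m k) hk
  have hr : rad m k x = Complex.exp (2 * Real.pi * Complex.I / m k) ^ (x k).val := by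
    rw [← Complex.exp_nat_mul, rad]
    congr 1
    ring
  have h1 : rad m k x ≠ 1 := by
    rw [hr]
    exact hz.pow_ne_one_of_pos_of_lt (by simpa [ZMod.val_eq_zero] using h) (ZMod.val_lt _)
  rw [geom_sum_eq h1, hr, pow_right_comm, hz.pow_eq_one, one_pow, sub_self, zero_div]

lemma measurable_rad (k : ℕ) : Measurable (rad m k) := by
  have h : Measurable fun z : ZMod (m k) =>
      Complex.exp (2 * (Real.pi : ℂ) * Complex.I * (z.val : ℂ) / (m k : ℂ)) :=
    fun _ _ => trivial
  exact h.comp (measurable_pi_apply k)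

lemma measurable_psi (n : ℕ) : Measurable (psi m n) := by
  unfold psi
  exact Finset.measurable_fun_prod _ fun k _ => (measurable_rad k).pow_const _

lemma measurableSet_cyl (n : ℕ) (x : G m) : MeasurableSet (cyl m n x) := by
  have : cyl m n x = ⋂ j, ⋂ _ : j < n, (fun y : G m => y j) ⁻¹' {x j} := by
    ext y; simp [cyl]
  rw [this]
  exact MeasurableSet.iInter fun j => MeasurableSet.iInter fun _ =>
    measurable_pi_apply j trivial

section Kernel

/-- The character `ψ_k` evaluated at the difference `x - t`. -/
def kernelTerm (m : ℕ → ℕ) (x t : G m) (k : ℕ) : ℂ :=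
  psi m k x * (starRingEnd ℂ) (psi m k t)

variable {x t : G m}

lemma norm_kernelTerm (k : ℕ) : ‖kernelTerm m x t k‖ = 1 := by
  simp [kernelTerm, norm_psi]

lemma kernelTerm_mul_M_add (hm : ∀ k, 2 ≤ m k) (s q r : ℕ) (hr : r < M m s) :
    kernelTerm m x t (q * M m s + r) = kernelTerm m x t (q * M m s) * kernelTerm m x t r := by
  simp only [kernelTerm, psi_mul_M_add hm q hr, map_mul]
  ring

lemma sum_kernelTerm_mul_M_eq_zero (hm : ∀ k, 2 ≤ m k) {s : ℕ} (hx : x s ≠ 0) (ht : t s = 0) :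
    ∑ q ∈ range (m s), kernelTerm m x t (q * M m s) = 0 := by
  rw [← sum_rad_pow_eq_zero hm hx]
  refine sum_congr rfl fun q hq => ?_
  have hq := mem_range.1 hq
  simp [kernelTerm, psi_mul_M hm hq, rad_of_eq_zero ht]

lemma sum_kernelTerm_eq_zero (hm : ∀ k, 2 ≤ m k) {i s : ℕ} (hx : x i ≠ 0) (ht : t i = 0)
    (h : i < s) : ∑ k ∈ range (M m s), kernelTerm m x t k = 0 := by
  induction s, h using Nat.le_induction with
  | base =>
    rw [M, sum_range_mul_of_block (kernelTerm_mul_M_add hm i),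
      sum_kernelTerm_mul_M_eq_zero hm hx ht, zero_mul]
  | succ s _ ih => rw [M, sum_range_mul_of_block (kernelTerm_mul_M_add hm s), ih, mul_zero]

lemma norm_sum_kernelTerm_le (hm : ∀ k, 2 ≤ m k) {i : ℕ} (hx : x i ≠ 0) (ht : t i = 0)
    (n : ℕ) : ‖∑ k ∈ range n, kernelTerm m x t k‖ ≤ M m (i + 1) := by
  simpa using norm_sum_range_le_of_block (M_pos hm _) (kernelTerm_mul_M_add hm (i + 1))
    (fun q => (norm_kernelTerm _).le) (sum_kernelTerm_eq_zero hm hx ht i.lt_succ_self)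
    (fun k => (norm_kernelTerm k).le) n

lemma norm_sum_sum_kernelTerm_le (hm : ∀ k, 2 ≤ m k) {i j : ℕ} (hij : i < j)
    (hxi : x i ≠ 0) (hti : t i = 0) (hxj : x j ≠ 0) (htj : t j = 0) (n : ℕ) :
    ‖∑ l ∈ range n, ∑ k ∈ range l, kernelTerm m x t k‖ ≤ M m (j + 1) * M m (i + 1) := by
  have hblock : ∀ s, i < s → ∀ q, ∀ r < M m s,
      ∑ k ∈ range (q * M m s + r), kernelTerm m x t k =
        kernelTerm m x t (q * M m s) * ∑ k ∈ range r, kernelTerm m x t k := fun s hs q r hr =>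
    sum_range_of_block (w := fun q => kernelTerm m x t (q * M m s))
      (kernelTerm_mul_M_add hm s) (sum_kernelTerm_eq_zero hm hxi hti hs) q r hr
  refine norm_sum_range_le_of_block (M_pos hm _) (hblock (j + 1) (hij.trans j.lt_succ_self))
    (fun q => (norm_kernelTerm _).le) ?_ (norm_sum_kernelTerm_le hm hxi hti) n
  rw [M, sum_range_mul_of_block (hblock j hij), sum_kernelTerm_mul_M_eq_zero hm hxj htj, zero_mul]

end Kernel

section Integral

variable {μ : Measure (G m)} {a : G m → ℂ}

lemma integrable_mul_kernelTerm (ha : Integrable a μ) (x : G m) (k : ℕ) :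
    Integrable (fun t => a t * kernelTerm m x t k) μ := by
  refine ha.mul_bdd (c := 1) ?_ (Filter.Eventually.of_forall fun t => (norm_kernelTerm k).le)
  exact (measurable_const.mul
    (Complex.continuous_conj.measurable.comp (measurable_psi k))).aestronglyMeasurable

lemma sigma_eq_integral (ha : Integrable a μ) (n : ℕ) (x : G m) :
    sigma m μ a n x =
      (n : ℂ)⁻¹ * ∫ t, a t * ∑ l ∈ range n, ∑ k ∈ range l, kernelTerm m x t k ∂μ := by
  have hi := integrable_mul_kernelTerm ha x
  simp only [mul_sum (range _)]
  rw [sigma, integral_finsetSum _ fun l _ => integrable_finsetSum _ fun k _ => hi k]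
  congr 1
  refine sum_congr rfl fun l _ => ?_
  rw [integral_finsetSum _ fun k _ => hi k, S]
  refine sum_congr rfl fun k _ => ?_
  rw [fhat, ← integral_mul_const]
  congr 1
  ext t
  rw [kernelTerm]
  ring

lemma norm_sigma_le {A B : ℝ} (hμ : IsVilenkinMeasure m μ) (ha : Measurable a)
    (hA : ∀ x, ‖a x‖ ≤ A) {N : ℕ} (hsupp : ∀ x, x ∉ cyl m N 0 → a x = 0) (n : ℕ) (x : G m)
    (hB : ∀ t ∈ cyl m N 0, ‖∑ l ∈ range n, ∑ k ∈ range l, kernelTerm m x t k‖ ≤ B) :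
    ‖sigma m μ a n x‖ ≤ (n : ℝ)⁻¹ * (A * B * (M m N : ℝ)⁻¹) := by
  have := hμ.1
  have hint : Integrable a μ :=
    (integrable_const A).mono' ha.aestronglyMeasurable (Filter.Eventually.of_forall hA)
  have hA0 : 0 ≤ A := (norm_nonneg _).trans (hA 0)
  have hcyl : μ.real (cyl m N 0) = (M m N : ℝ)⁻¹ := by
    simp [Measure.real, hμ.2 N 0]
  rw [sigma_eq_integral hint, norm_mul, norm_inv, Complex.norm_natCast,
    ← setIntegral_eq_integral_of_forall_compl_eq_zero (s := cyl m N 0)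
      (fun t ht => by rw [hsupp t ht, zero_mul]), ← hcyl]
  gcongr
  refine norm_setIntegral_le_of_norm_le_const (measure_lt_top _ _) fun t ht => ?_
  rw [norm_mul]
  exact mul_le_mul (hA t) (hB t ht) (norm_nonneg _) hA0

end Integral

end Vilenkin

open Vilenkin

theorem statement15 (lam : ℕ) :
    ∃ c : ℝ, 0 < c ∧ ∀ (m : ℕ → ℕ), (∀ k, 2 ≤ m k) → (∀ k, m k ≤ lam) →
      ∀ (μ : Measure (G m)), IsVilenkinMeasure m μ →
      ∀ p : ℝ, 0 < p → p ≤ 1 / 2 →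
      ∀ N : ℕ, 1 ≤ N → ∀ a : G m → ℂ, Measurable a →
        (∀ x, ‖a x‖ ≤ (M m N : ℝ) ^ (1 / p)) →
        (∀ x, x ∉ cyl m N 0 → a x = 0) → (∫ x, a x ∂μ) = 0 →
      ∀ n : ℕ, 1 ≤ n → M m N ≤ n → ∀ i j : ℕ, i < j → j ≤ N → ∀ x ∈ Iij m N i j,
      ‖sigma m μ a n x‖ ≤
        c * (M m N : ℝ) ^ (1 / p - 2) * (M m i : ℝ) * (M m j : ℝ) := by
  refine ⟨(lam : ℝ) ^ 2 + 1, by positivity, ?_⟩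
  intro m hm hlam μ hμ p _ _ N _ a ha hA hsupp _ n hn1 hn i j hij hjN x hx
  have hMpos : ∀ k, (0 : ℝ) < M m k := fun k => by exact_mod_cast M_pos hm k
  have hMsucc : ∀ k, (M m (k + 1) : ℝ) ≤ lam * M m k := fun k => by
    rw [M]
    exact_mod_cast Nat.mul_le_mul_right _ (hlam k)
  have hlam1 : (1 : ℝ) ≤ lam := by
    exact_mod_cast (Nat.le_of_lt (hm 0)).trans (hlam 0)
  have hn0 : (0 : ℝ) < n := by exact_mod_cast hn1
  have hnN : (M m N : ℝ) ≤ n := by exact_mod_cast hn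
  have hpow : (M m N : ℝ) ^ (1 / p - 2) = (M m N : ℝ) ^ (1 / p) * ((M m N : ℝ) ^ 2)⁻¹ := by
    rw [Real.rpow_sub (hMpos N), div_eq_mul_inv]
    norm_num
  set A := (M m N : ℝ) ^ (1 / p)
  have hA0 : 0 ≤ A := Real.rpow_nonneg (hMpos N).le _
  have hi := hMpos i
  have hj := hMpos j
  have hN := hMpos N
  have hxi : x i ≠ 0 := by
    unfold Iij at hx
    split_ifs at hx
    exacts [hx.1, hx.2.1]
  rw [hpow]
  rcases hjN.eq_or_lt with rfl | hjN
  · have hbound := norm_sigma_le (B := n * (lam * M m i)) hμ ha hA hsupp n x fun t ht => by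
      refine (norm_sum_le _ _).trans ?_
      simpa using sum_le_card_nsmul (range n) _ (lam * M m i : ℝ) fun l _ =>
        (norm_sum_kernelTerm_le hm hxi (ht i hij) l).trans (hMsucc i)
    calc _ ≤ _ := hbound
      _ = lam * (A * ((M m j : ℝ) ^ 2)⁻¹ * M m i * M m j) := by field_simp
      _ ≤ ((lam : ℝ) ^ 2 + 1) * (A * ((M m j : ℝ) ^ 2)⁻¹ * M m i * M m j) := by
        gcongr
        nlinarith
      _ = _ := by ring
  · have hxj : x j ≠ 0 := by
      rw [Iij, if_neg hjN.ne] at hx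
      exact hx.2.2.2
    have hbound := norm_sigma_le (B := (lam * M m j) * (lam * M m i)) hμ ha hA hsupp n x
      fun t ht => (norm_sum_sum_kernelTerm_le hm hij hxi (ht i (hij.trans hjN)) hxj
        (ht j hjN) n).trans (by gcongr <;> exact hMsucc _)
    calc _ ≤ _ := hbound
      _ ≤ (M m N : ℝ)⁻¹ * (A * ((lam * M m j) * (lam * M m i)) * (M m N : ℝ)⁻¹) := by gcongr
      _ = (lam : ℝ) ^ 2 * (A * ((M m N : ℝ) ^ 2)⁻¹ * M m i * M m j) := by field_simp
      _ ≤ ((lam : ℝ) ^ 2 + 1) * (A * ((M m N : ℝ) ^ 2)⁻¹ * M m i * M m j) := by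
        gcongr
        linarith
      _ = _ := by ring
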